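/- Fix 1 ≤ p < ∞ and W ∈ 𝕎. Then the Garling function space G_{W,p}(0,∞) is complete: if (f_i)_{i=1}^∞ is a sequence of measurable functions on (0,∞) with ρ_G(|f_i|) < ∞ for all i and which is Cauchy in the sense that for every ε > 0 there is N such that ρ_G(|f_i - f_j|) < ε for all i, j ≥ N, then there exists a measurable function f : (0,∞) → ℝ with ρ_G(|f|) < ∞ and ρ_G(|f - f_i|) → 0 as i → ∞. -/

import Mathlib

open MeasureTheory Set ENNReal Filter

/-- An MO-isomorphism between subsets `E, F` of `ℝ`: a strictly increasing bijection from `E`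
onto `F` such that both it and its inverse are measure-preserving for Lebesgue measure. -/
structure MOIso (E F : Set ℝ) (m : ℝ → ℝ) : Prop where
  bijOn : Set.BijOn m E F
  strictMonoOn : StrictMonoOn m E
  measPres : ∀ A : Set ℝ, A ⊆ F → NullMeasurableSet A volume →
    NullMeasurableSet (E ∩ m ⁻¹' A) volume ∧ volume (E ∩ m ⁻¹' A) = volume A
  invMeasPres : ∀ B : Set ℝ, B ⊆ E → NullMeasurableSet B volume →
    NullMeasurableSet (m '' B) volume ∧ volume (m '' B) = volume B

/-- The class `𝕎` of weights: nonincreasing Lebesgue-measurable `W : (0,∞) → (0,∞)` with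
`W(t) → 0` as `t → ∞`, `∫_0^∞ W = ∞` and `∫_0^1 W < ∞`. -/
def memW (W : ℝ → ℝ) : Prop :=
  AntitoneOn W (Ioi 0) ∧ (∀ t ∈ Ioi (0:ℝ), 0 < W t) ∧ AEMeasurable W volume ∧
    Tendsto W atTop (nhds 0) ∧
    (∫⁻ t in Ioi (0:ℝ), ENNReal.ofReal (W t)) = ∞ ∧
    (∫⁻ t in Ioc (0:ℝ) 1, ENNReal.ofReal (W t)) < ∞

/-- The Garling function norm
`ρ_G(f) = sup over E, F ⊆ (0,∞) and MO-isomorphisms m : E → F of (∫_E f(m t)^p W(t) dt)^{1/p}`. -/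
noncomputable def rhoG (p : ℝ) (W : ℝ → ℝ) (f : ℝ → ℝ≥0∞) : ℝ≥0∞ :=
  ⨆ (E : Set ℝ) (F : Set ℝ) (m : ℝ → ℝ) (_ : E ⊆ Ioi 0) (_ : F ⊆ Ioi 0)
    (_ : NullMeasurableSet E volume) (_ : NullMeasurableSet F volume) (_ : MOIso E F m),
    (∫⁻ t in E, f (m t) ^ p * ENNReal.ofReal (W t)) ^ (1 / p)

/-- The identity is an MO-isomorphism from any set to itself. -/
theorem MOIso.refl (E : Set ℝ) : MOIso E E id where
  bijOn := Set.bijOn_id E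
  strictMonoOn := strictMonoOn_id
  measPres A hA h := by
    rw [preimage_id, inter_eq_self_of_subset_right hA]
    exact ⟨h, rfl⟩
  invMeasPres B _ h := by
    rw [image_id]
    exact ⟨h, rfl⟩

/-- The composition of a measurable function with an MO-isomorphism is a.e.-measurable on its
domain. -/
theorem MOIso.aemeasurable_comp {E F : Set ℝ} {m : ℝ → ℝ} (h : MOIso E F m)
    (hE : NullMeasurableSet E volume) (hF : NullMeasurableSet F volume)
    {f : ℝ → ℝ≥0∞} (hf : Measurable f) :
    AEMeasurable (fun t => f (m t)) (volume.restrict E) := by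
  refine NullMeasurable.aemeasurable fun s hs => ?_
  have key := (h.measPres (F ∩ f ⁻¹' s) inter_subset_left
    (hF.inter (hf hs).nullMeasurableSet)).1
  have hset : E ∩ m ⁻¹' (F ∩ f ⁻¹' s) = (fun t => f (m t)) ⁻¹' s ∩ E := by
    ext t
    constructor
    · rintro ⟨ht, -, hts⟩
      exact ⟨hts, ht⟩
    · rintro ⟨hts, ht⟩
      exact ⟨ht, h.bijOn.mapsTo ht, hts⟩
  rw [hset] at key
  exact (nullMeasurableSet_restrict hE).2 key

/-- Properties holding a.e. on `(0,∞)` pull back along an MO-isomorphism. -/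
theorem MOIso.ae_comp {E F : Set ℝ} {m : ℝ → ℝ} (h : MOIso E F m)
    (hE : NullMeasurableSet E volume) (hF : F ⊆ Ioi 0) {P : ℝ → Prop}
    (hP : ∀ᵐ x ∂volume.restrict (Ioi (0 : ℝ)), P x) :
    ∀ᵐ t ∂volume.restrict E, P (m t) := by
  rw [ae_restrict_iff' measurableSet_Ioi] at hP
  rw [ae_restrict_iff'₀ hE]
  have hnull : volume (F ∩ {x | ¬ P x}) = 0 := by
    refine measure_mono_null ?_ hP
    rintro x ⟨hx, hxP⟩ hx'
    exact hxP (hx' (hF hx))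
  have key := (h.measPres _ inter_subset_left (NullMeasurableSet.of_null hnull)).2
  rw [hnull] at key
  refine measure_mono_null ?_ key
  intro t ht
  obtain ⟨htE, htP⟩ := Classical.not_imp.1 ht
  exact ⟨htE, h.bijOn.mapsTo htE, htP⟩

theorem le_rhoG (p : ℝ) (W : ℝ → ℝ) (f : ℝ → ℝ≥0∞) {E F : Set ℝ} {m : ℝ → ℝ}
    (hE : E ⊆ Ioi 0) (hF : F ⊆ Ioi 0) (hEm : NullMeasurableSet E volume)
    (hFm : NullMeasurableSet F volume) (h : MOIso E F m) :
    (∫⁻ t in E, f (m t) ^ p * ENNReal.ofReal (W t)) ^ (1 / p) ≤ rhoG p W f := by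
  unfold rhoG
  exact le_iSup_of_le E <| le_iSup_of_le F <| le_iSup_of_le m <| le_iSup_of_le hE <|
    le_iSup_of_le hF <| le_iSup_of_le hEm <| le_iSup_of_le hFm <| le_iSup_of_le h le_rfl

theorem rhoG_le {p : ℝ} {W : ℝ → ℝ} {f : ℝ → ℝ≥0∞} {C : ℝ≥0∞}
    (hC : ∀ (E F : Set ℝ) (m : ℝ → ℝ), E ⊆ Ioi 0 → F ⊆ Ioi 0 → NullMeasurableSet E volume →
      NullMeasurableSet F volume → MOIso E F m →
      (∫⁻ t in E, f (m t) ^ p * ENNReal.ofReal (W t)) ^ (1 / p) ≤ C) :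
    rhoG p W f ≤ C := by
  unfold rhoG
  exact iSup_le fun E => iSup_le fun F => iSup_le fun m => iSup_le fun hE => iSup_le fun hF =>
    iSup_le fun hEm => iSup_le fun hFm => iSup_le fun h => hC E F m hE hF hEm hFm h

/-- The Garling function norm is monotone. -/
theorem rhoG_mono {p : ℝ} (hp : 0 ≤ p) (W : ℝ → ℝ) {f g : ℝ → ℝ≥0∞} (hfg : ∀ t, f t ≤ g t) :
    rhoG p W f ≤ rhoG p W g := by
  refine rhoG_le fun E F m hE hF hEm hFm h => le_trans ?_ (le_rhoG p W g hE hF hEm hFm h)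
  gcongr
  exact hfg _

/-- The triangle inequality for the Garling function norm. -/
theorem rhoG_add_le {p : ℝ} (hp : 1 ≤ p) {W : ℝ → ℝ} (hW : AEMeasurable W volume)
    {f g : ℝ → ℝ≥0∞} (hf : Measurable f) (hg : Measurable g) :
    rhoG p W (fun t => f t + g t) ≤ rhoG p W f + rhoG p W g := by
  have hp0 : 0 < p := zero_lt_one.trans_le hp
  refine rhoG_le fun E F m hE hF hEm hFm h => ?_
  have hw : AEMeasurable (fun t => ENNReal.ofReal (W t) ^ (1 / p)) (volume.restrict E) :=
    hW.restrict.ennreal_ofReal.pow_const _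
  have hpow : ∀ a b : ℝ≥0∞, (a * b ^ (1 / p)) ^ p = a ^ p * b := fun a b => by
    rw [ENNReal.mul_rpow_of_nonneg _ _ hp0.le, ← ENNReal.rpow_mul, one_div_mul_cancel hp0.ne',
      ENNReal.rpow_one]
  have key := ENNReal.lintegral_Lp_add_le ((h.aemeasurable_comp hEm hFm hf).mul hw)
    ((h.aemeasurable_comp hEm hFm hg).mul hw) hp
  simp only [Pi.add_apply, Pi.mul_apply, ← add_mul, hpow] at key
  exact key.trans (add_le_add (le_rhoG p W f hE hF hEm hFm h) (le_rhoG p W g hE hF hEm hFm h))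

/-- The Fatou property of the Garling function norm. -/
theorem rhoG_le_of_ae_tendsto {p : ℝ} (hp : 0 < p) {W : ℝ → ℝ} (hW : AEMeasurable W volume)
    {f : ℕ → ℝ → ℝ≥0∞} {g : ℝ → ℝ≥0∞} (hf : ∀ k, Measurable (f k))
    (hlim : ∀ᵐ x ∂volume.restrict (Ioi (0 : ℝ)),
      Tendsto (fun k => f k x) atTop (nhds (g x)))
    {C : ℝ≥0∞} (hC : ∀ᶠ k in atTop, rhoG p W (f k) ≤ C) :
    rhoG p W g ≤ C := by
  refine rhoG_le fun E F m hE hF hEm hFm h => ?_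
  rw [one_div, ENNReal.rpow_inv_le_iff hp]
  calc ∫⁻ t in E, g (m t) ^ p * ENNReal.ofReal (W t)
      = ∫⁻ t in E, liminf (fun k => f k (m t) ^ p * ENNReal.ofReal (W t)) atTop := by
        refine lintegral_congr_ae ?_
        filter_upwards [h.ae_comp hEm hF hlim] with t ht
        refine (Tendsto.liminf_eq ?_).symm
        exact ENNReal.Tendsto.mul_const ((ENNReal.continuous_rpow_const.tendsto _).comp ht)
          (Or.inr ENNReal.ofReal_ne_top)
    _ ≤ liminf (fun k => ∫⁻ t in E, f k (m t) ^ p * ENNReal.ofReal (W t)) atTop :=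
        lintegral_liminf_le' fun k =>
          ((h.aemeasurable_comp hEm hFm (hf k)).pow_const _).mul hW.restrict.ennreal_ofReal
    _ ≤ C ^ p := by
        refine liminf_le_of_frequently_le' (Eventually.frequently ?_)
        filter_upwards [hC] with k hk
        rw [← ENNReal.rpow_inv_le_iff hp, ← one_div]
        exact (le_rhoG p W (f k) hE hF hEm hFm h).trans hk

/-- The Garling function norm dominates the norm of the weighted space `L^p(W dt)`. -/
theorem eLpNorm_withDensity_le_rhoG {p : ℝ} (hp : 0 < p) {W : ℝ → ℝ}
    (hW : AEMeasurable W volume) (f : ℝ → ℝ) :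
    eLpNorm f (ENNReal.ofReal p)
      ((volume.restrict (Ioi 0)).withDensity fun t => ENNReal.ofReal (W t)) ≤
      rhoG p W (fun t => ENNReal.ofReal |f t|) := by
  refine le_trans (le_of_eq ?_) (le_rhoG p W _ subset_rfl subset_rfl
    measurableSet_Ioi.nullMeasurableSet measurableSet_Ioi.nullMeasurableSet (MOIso.refl (Ioi 0)))
  rw [eLpNorm_eq_lintegral_rpow_enorm_toReal (ENNReal.ofReal_pos.2 hp).ne' ENNReal.ofReal_ne_top,
    ENNReal.toReal_ofReal hp.le,
    lintegral_withDensity_eq_lintegral_mul_non_measurable₀ _ hW.restrict.ennreal_ofReal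
      (by simp)]
  congr 1
  refine lintegral_congr fun t => ?_
  simp [Real.enorm_eq_ofReal_abs, mul_comm]

/-- For `1 ≤ p < ∞` and `W ∈ 𝕎`, the Garling function space `G_{W,p}(0,∞)`
is complete: every Cauchy sequence (in the norm `ρ_G`) converges to some element. -/
theorem stmt9 (p : ℝ) (hp : 1 ≤ p) (W : ℝ → ℝ) (hW : memW W)
    (f : ℕ → ℝ → ℝ) (hmeas : ∀ i, Measurable (f i))
    (hfin : ∀ i, rhoG p W (fun t => ENNReal.ofReal |f i t|) < ∞)
    (hcauchy : ∀ ε : ℝ, 0 < ε → ∃ N : ℕ, ∀ i ≥ N, ∀ j ≥ N,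
      rhoG p W (fun t => ENNReal.ofReal |f i t - f j t|) < ENNReal.ofReal ε) :
    ∃ g : ℝ → ℝ, Measurable g ∧ rhoG p W (fun t => ENNReal.ofReal |g t|) < ∞ ∧
      Filter.Tendsto (fun i => rhoG p W (fun t => ENNReal.ofReal |g t - f i t|))
        Filter.atTop (nhds 0) := by
  have hp0 : 0 < p := zero_lt_one.trans_le hp
  obtain ⟨-, hWpos, hWm, -, -, -⟩ := hW
  have hcauchy' : ∀ k : ℕ, ∃ N : ℕ, ∀ n ≥ N, ∀ i ≥ n, ∀ j ≥ n,
      rhoG p W (fun t => ENNReal.ofReal |f i t - f j t|) < ENNReal.ofReal ((1 / 2) ^ k) :=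
    fun k => (hcauchy ((1 / 2) ^ k) (by positivity)).imp fun N hN n hn i hi j hj =>
      hN i (hn.trans hi) j (hn.trans hj)
  obtain ⟨φ, hφ, hφC⟩ := extraction_forall_of_eventually' hcauchy'
  have hae : ∀ᵐ x ∂volume.restrict (Ioi (0 : ℝ)),
      ∃ l, Tendsto (fun k => f (φ k) x) atTop (nhds l) := by
    have hsum : ∑' k : ℕ, ENNReal.ofReal ((1 / 2) ^ k) ≠ ∞ := by
      rw [← ENNReal.ofReal_tsum_of_nonneg (fun k => by positivity) summable_geometric_two]
      exact ENNReal.ofReal_ne_top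
    have hconv := Lp.ae_tendsto_of_cauchy_eLpNorm
      (μ := (volume.restrict (Ioi 0)).withDensity fun t => ENNReal.ofReal (W t))
      (p := ENNReal.ofReal p) (f := fun k => f (φ k))
      (fun k => (hmeas (φ k)).aestronglyMeasurable) (ENNReal.one_le_ofReal.2 hp) hsum
      fun N n m hn hm => (eLpNorm_withDensity_le_rhoG hp0 hWm _).trans_lt
        (hφC N _ (hφ.monotone hn) _ (hφ.monotone hm))
    rw [ae_withDensity_iff' hWm.restrict.ennreal_ofReal] at hconv
    filter_upwards [hconv, ae_restrict_mem measurableSet_Ioi] with x hx hx0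
    exact hx (ENNReal.ofReal_pos.2 (hWpos x hx0)).ne'
  obtain ⟨g, hg, hglim⟩ := measurable_limit_of_tendsto_metrizable_ae
    (fun k => (hmeas (φ k)).aemeasurable) hae
  have hdist : ∀ (ε : ℝ) (N : ℕ), (∀ i ≥ N, ∀ j ≥ N,
      rhoG p W (fun t => ENNReal.ofReal |f i t - f j t|) < ENNReal.ofReal ε) →
      ∀ i ≥ N, rhoG p W (fun t => ENNReal.ofReal |g t - f i t|) ≤ ENNReal.ofReal ε := by
    intro ε N hN i hi
    refine rhoG_le_of_ae_tendsto hp0 hWm (f := fun k t => ENNReal.ofReal |f (φ k) t - f i t|)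
      (fun k => ((hmeas _).sub (hmeas i)).abs.ennreal_ofReal) ?_ ?_
    · filter_upwards [hglim] with x hx
      exact ENNReal.tendsto_ofReal (hx.sub_const _).abs
    · filter_upwards [eventually_ge_atTop N] with k hk
      exact (hN _ (hk.trans (hφ.id_le k)) i hi).le
  refine ⟨g, hg, ?_, ?_⟩
  · obtain ⟨N, hN⟩ := hcauchy 1 one_pos
    calc rhoG p W (fun t => ENNReal.ofReal |g t|)
        ≤ rhoG p W (fun t => ENNReal.ofReal |g t - f N t| + ENNReal.ofReal |f N t|) := by
          refine rhoG_mono hp0.le W fun t => ?_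
          rw [← ENNReal.ofReal_add (abs_nonneg _) (abs_nonneg _)]
          refine ENNReal.ofReal_le_ofReal ?_
          simpa using abs_add_le (g t - f N t) (f N t)
      _ ≤ _ := rhoG_add_le hp hWm (hg.sub (hmeas N)).abs.ennreal_ofReal
          (hmeas N).abs.ennreal_ofReal
      _ < ∞ := ENNReal.add_lt_top.2
          ⟨(hdist 1 N hN N le_rfl).trans_lt ENNReal.ofReal_lt_top, hfin N⟩
  · rw [ENNReal.tendsto_atTop_zero]
    intro ε hε
    obtain ⟨δ, -, hδ, hδε⟩ := ENNReal.lt_iff_exists_real_btwn.1 hε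
    obtain ⟨N, hN⟩ := hcauchy δ (ENNReal.ofReal_pos.1 hδ)
    exact ⟨N, fun i hi => (hdist δ N hN i hi).trans hδε.le⟩
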